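/- Let n ≥ 1 and let F₀ be an invertible real n×n matrix. Then for every smooth compactly supported vector field ζ : ℝⁿ → ℝⁿ, ∫_{ℝⁿ} |∇ζ(x)|² dx ≤ 2 |F₀|² ∫_{ℝⁿ} |sym(∇ζ(x) F₀^{-1})|² dx. (This is the Korn-type inequality (1.8) for M = D_Q 𝒵₀'(F₀,Q₀), where 𝒵₀'(F,Q) = 2(det F) sym(QF^{-1}) F^{-1,T} and ⟨D_Q𝒵₀'(F₀,Q₀)Q : Q⟩ = 2(det F₀)|sym(QF₀^{-1})|², as well as for M = D_Q𝒵₀(F₀,Q₀) with 𝒵₀(F,Q) = sym(QF^{-1}) F^{-1,T}.) -/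

import Mathlib

open Matrix MeasureTheory

/-- The Jacobian matrix of a vector field `ζ : ℝⁿ → ℝⁿ`: `(jac ζ x) i j = ∂ζ_i/∂x_j (x)`. -/
noncomputable def jac {n : ℕ} (ζ : (Fin n → ℝ) → (Fin n → ℝ)) (x : Fin n → ℝ) :
    Matrix (Fin n) (Fin n) ℝ :=
  Matrix.of fun i j => fderiv ℝ ζ x (Pi.single j 1) i

/-- The Frobenius inner product `⟨A : B⟩ = tr(Aᵀ B)`. -/
noncomputable def mip {n : ℕ} (A B : Matrix (Fin n) (Fin n) ℝ) : ℝ :=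
  (Aᵀ * B).trace


/-- The symmetric part `sym F = (F + Fᵀ)/2`. -/
noncomputable def msym {n : ℕ} (A : Matrix (Fin n) (Fin n) ℝ) : Matrix (Fin n) (Fin n) ℝ :=
  (2 : ℝ)⁻¹ • (A + Aᵀ)

section KornType

variable {n : ℕ}

lemma mip_eq_sum (A B : Matrix (Fin n) (Fin n) ℝ) :
    mip A B = ∑ i, ∑ j, A i j * B i j := by
  simp only [mip, Matrix.trace, Matrix.diag_apply, Matrix.mul_apply, Matrix.transpose_apply]
  exact Finset.sum_comm

lemma mip_self_nonneg (A : Matrix (Fin n) (Fin n) ℝ) : 0 ≤ mip A A := by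
  rw [mip_eq_sum]
  exact Finset.sum_nonneg fun i _ => Finset.sum_nonneg fun j _ => mul_self_nonneg _

/-- Submultiplicativity of the squared Frobenius norm. -/
lemma mip_mul_self_le (A B : Matrix (Fin n) (Fin n) ℝ) :
    mip (A * B) (A * B) ≤ mip A A * mip B B := by
  have hB : mip B B = ∑ j, ∑ k, B k j ^ 2 := by
    rw [mip_eq_sum, Finset.sum_comm]
    simp only [sq]
  rw [hB, mip_eq_sum, mip_eq_sum, Finset.sum_mul_sum]
  refine Finset.sum_le_sum fun i _ => Finset.sum_le_sum fun j _ => ?_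
  simp only [Matrix.mul_apply, ← sq]
  exact Finset.sum_mul_sq_le_sq_mul_sq _ _ _

lemma two_mul_mip_msym_self (G : Matrix (Fin n) (Fin n) ℝ) :
    2 * mip (msym G) (msym G) = mip G G + (G * G).trace := by
  have h₁ : (Gᵀ * Gᵀ).trace = (G * G).trace := by
    rw [← Matrix.transpose_mul, Matrix.trace_transpose]
  have h₂ : (G * Gᵀ).trace = (Gᵀ * G).trace := Matrix.trace_mul_comm _ _
  simp only [mip, msym, Matrix.transpose_smul, Matrix.transpose_add, Matrix.transpose_transpose,
    Matrix.smul_mul, Matrix.mul_smul, Matrix.trace_smul, Matrix.add_mul, Matrix.mul_add,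
    Matrix.trace_add, h₁, h₂, smul_eq_mul]
  ring

variable {E : Type*} [NormedAddCommGroup E] [NormedSpace ℝ E]

lemma ContDiff.continuous_fderiv_const_apply {f : E → ℝ} (hf : ContDiff ℝ 2 f) (u : E) :
    Continuous fun x => fderiv ℝ f x u :=
  (hf.continuous_fderiv two_ne_zero).clm_apply continuous_const

variable [MeasurableSpace E] [BorelSpace E]
  {μ : Measure E} [μ.IsAddHaarMeasure]

lemma integrable_fderiv_mul_fderiv {f g : E → ℝ} (hf : ContDiff ℝ 2 f) (hg : ContDiff ℝ 2 g)
    (hfc : HasCompactSupport f) (u v : E) :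
    Integrable (fun x => fderiv ℝ f x u * fderiv ℝ g x v) μ :=
  ((hf.continuous_fderiv_const_apply u).mul
    (hg.continuous_fderiv_const_apply v)).integrable_of_hasCompactSupport
      (hfc.fderiv_apply ℝ u).mul_right

/-- Directions of differentiation can be exchanged in the integral of a product of two
directional derivatives. -/
lemma integral_fderiv_mul_fderiv_swap [FiniteDimensional ℝ E] {f g : E → ℝ}
    (hf : ContDiff ℝ 2 f) (hg : ContDiff ℝ 2 g) (hfc : HasCompactSupport f) (u v : E) :
    ∫ x, fderiv ℝ f x u * fderiv ℝ g x v ∂μ = ∫ x, fderiv ℝ f x v * fderiv ℝ g x u ∂μ := by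
  have hdg : ContDiff ℝ 1 (fderiv ℝ g) := hg.fderiv_right (by norm_num)
  have hdgw (w : E) : ContDiff ℝ 1 fun x => fderiv ℝ g x w := hdg.clm_apply contDiff_const
  have hsnd (w z x : E) :
      fderiv ℝ (fun y => fderiv ℝ g y w) x z = fderiv ℝ (fderiv ℝ g) x z w := by
    rw [fderiv_clm_apply (hdg.differentiable one_ne_zero x) (differentiableAt_const w)]
    simp
  have parts (w z : E) : ∫ x, f x * fderiv ℝ (fun y => fderiv ℝ g y w) x z ∂μ
      = -∫ x, fderiv ℝ f x z * fderiv ℝ g x w ∂μ := by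
    refine integral_mul_fderiv_eq_neg_fderiv_mul_of_integrable
      (integrable_fderiv_mul_fderiv hf hg hfc z w) ?_ ?_
      (fun x _ => hf.differentiable two_ne_zero x)
      (fun x _ => (hdgw w).differentiable one_ne_zero x)
    · exact (hf.continuous.mul (((hdgw w).continuous_fderiv one_ne_zero).clm_apply
        continuous_const)).integrable_of_hasCompactSupport hfc.mul_right
    · exact (hf.continuous.mul
        (hdgw w).continuous).integrable_of_hasCompactSupport hfc.mul_right
  have hsymm (x : E) : IsSymmSndFDerivAt ℝ g x :=
    hg.contDiffAt.isSymmSndFDerivAt (by simp)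
  rw [← neg_inj, ← parts v u, ← parts u v]
  simp only [hsnd, fun x => (hsymm x).eq u v]

lemma jac_mul_apply {ζ : (Fin n → ℝ) → (Fin n → ℝ)} (hζ : Differentiable ℝ ζ)
    (A : Matrix (Fin n) (Fin n) ℝ) (x : Fin n → ℝ) (i j : Fin n) :
    (jac ζ x * A) i j = fderiv ℝ (fun y => ζ y i) x (fun k => A k j) := by
  have hi : fderiv ℝ (fun y => ζ y i) x (fun k => A k j) = fderiv ℝ ζ x (fun k => A k j) i := by
    rw [fderiv_apply (hζ x)]
    rfl
  rw [hi, pi_eq_sum_univ' (fun k => A k j)]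
  simp only [Matrix.mul_apply, jac, Matrix.of_apply, map_sum, map_smul, Finset.sum_apply,
    Pi.smul_apply, smul_eq_mul]
  refine Finset.sum_congr rfl fun k _ => ?_
  rw [mul_comm]

lemma integrable_jac_mul_apply_mul {ζ : (Fin n → ℝ) → (Fin n → ℝ)} (hζ : ContDiff ℝ 2 ζ)
    (hζc : HasCompactSupport ζ) (A : Matrix (Fin n) (Fin n) ℝ) (i j k l : Fin n) :
    Integrable fun x => (jac ζ x * A) i j * (jac ζ x * A) k l := by
  simp only [jac_mul_apply (hζ.differentiable two_ne_zero)]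
  exact integrable_fderiv_mul_fderiv (contDiff_pi.1 hζ i) (contDiff_pi.1 hζ k)
    (hζc.comp_left (g := fun y : Fin n → ℝ => y i) rfl) _ _

lemma integrable_mip_jac_mul {ζ : (Fin n → ℝ) → (Fin n → ℝ)} (hζ : ContDiff ℝ 2 ζ)
    (hζc : HasCompactSupport ζ) (A : Matrix (Fin n) (Fin n) ℝ) :
    Integrable fun x => mip (jac ζ x * A) (jac ζ x * A) := by
  simp only [mip_eq_sum]
  exact integrable_finsetSum _ fun i _ => integrable_finsetSum _ fun j _ =>
    integrable_jac_mul_apply_mul hζ hζc A i j i j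

lemma integrable_trace_jac_mul_sq {ζ : (Fin n → ℝ) → (Fin n → ℝ)} (hζ : ContDiff ℝ 2 ζ)
    (hζc : HasCompactSupport ζ) (A : Matrix (Fin n) (Fin n) ℝ) :
    Integrable fun x => ((jac ζ x * A) * (jac ζ x * A)).trace := by
  simp only [Matrix.trace, Matrix.diag_apply, Matrix.mul_apply (M := jac ζ _ * A)]
  exact integrable_finsetSum _ fun i _ => integrable_finsetSum _ fun j _ =>
    integrable_jac_mul_apply_mul hζ hζc A i j j i

/-- For `G = ∇ζ A`, the integrals of `tr (G²)` and `(tr G)²` agree. -/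
lemma integral_trace_jac_mul_sq {ζ : (Fin n → ℝ) → (Fin n → ℝ)} (hζ : ContDiff ℝ 2 ζ)
    (hζc : HasCompactSupport ζ) (A : Matrix (Fin n) (Fin n) ℝ) :
    ∫ x, ((jac ζ x * A) * (jac ζ x * A)).trace = ∫ x, (jac ζ x * A).trace ^ 2 := by
  have hint := integrable_jac_mul_apply_mul hζ hζc A
  simp only [sq, Matrix.trace, Matrix.diag_apply, Finset.sum_mul_sum,
    Matrix.mul_apply (M := jac ζ _ * A)]
  rw [integral_finsetSum _ fun i _ => integrable_finsetSum _ fun j _ => hint i j j i,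
    integral_finsetSum _ fun i _ => integrable_finsetSum _ fun j _ => hint i i j j]
  refine Finset.sum_congr rfl fun i _ => ?_
  rw [integral_finsetSum _ fun j _ => hint i j j i,
    integral_finsetSum _ fun j _ => hint i i j j]
  refine Finset.sum_congr rfl fun j _ => ?_
  simp only [jac_mul_apply (hζ.differentiable two_ne_zero)]
  exact integral_fderiv_mul_fderiv_swap (contDiff_pi.1 hζ i) (contDiff_pi.1 hζ j)
    (hζc.comp_left (g := fun y : Fin n → ℝ => y i) rfl) _ _

/-- Korn's inequality for `∇ζ A`, with constant `2`. -/
lemma integral_mip_jac_mul_le {ζ : (Fin n → ℝ) → (Fin n → ℝ)} (hζ : ContDiff ℝ 2 ζ)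
    (hζc : HasCompactSupport ζ) (A : Matrix (Fin n) (Fin n) ℝ) :
    ∫ x, mip (jac ζ x * A) (jac ζ x * A)
      ≤ 2 * ∫ x, mip (msym (jac ζ x * A)) (msym (jac ζ x * A)) := by
  rw [← integral_const_mul]
  simp only [two_mul_mip_msym_self]
  rw [integral_add (integrable_mip_jac_mul hζ hζc A) (integrable_trace_jac_mul_sq hζ hζc A),
    integral_trace_jac_mul_sq hζ hζc A]
  exact le_add_of_nonneg_right (integral_nonneg fun x => sq_nonneg _)

end KornType

theorem stmt_5 {n : ℕ} (hn : 1 ≤ n)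
    (F₀ : Matrix (Fin n) (Fin n) ℝ) (hF₀ : IsUnit F₀.det)
    (ζ : (Fin n → ℝ) → (Fin n → ℝ)) (hζ : ContDiff ℝ (⊤ : ℕ∞) ζ)
    (hζc : HasCompactSupport ζ) :
    ∫ x, mip (jac ζ x) (jac ζ x)
      ≤ 2 * mip F₀ F₀ *
        ∫ x, mip (msym (jac ζ x * F₀⁻¹)) (msym (jac ζ x * F₀⁻¹)) := by
  have hζ₂ : ContDiff ℝ 2 ζ := hζ.of_le (WithTop.coe_le_coe.2 le_top)
  have hpt (x : Fin n → ℝ) : mip (jac ζ x) (jac ζ x)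
      ≤ mip F₀ F₀ * mip (jac ζ x * F₀⁻¹) (jac ζ x * F₀⁻¹) := by
    have h := mip_mul_self_le (jac ζ x * F₀⁻¹) F₀
    rwa [Matrix.nonsing_inv_mul_cancel_right _ _ hF₀, mul_comm (mip _ _)] at h
  calc ∫ x, mip (jac ζ x) (jac ζ x)
      ≤ ∫ x, mip F₀ F₀ * mip (jac ζ x * F₀⁻¹) (jac ζ x * F₀⁻¹) :=
        integral_mono_of_nonneg (.of_forall fun x => mip_self_nonneg _)
          ((integrable_mip_jac_mul hζ₂ hζc _).const_mul _) (.of_forall hpt)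
    _ = mip F₀ F₀ * ∫ x, mip (jac ζ x * F₀⁻¹) (jac ζ x * F₀⁻¹) := integral_const_mul _ _
    _ ≤ mip F₀ F₀ * (2 * ∫ x, mip (msym (jac ζ x * F₀⁻¹)) (msym (jac ζ x * F₀⁻¹))) :=
        mul_le_mul_of_nonneg_left (integral_mip_jac_mul_le hζ₂ hζc _) (mip_self_nonneg _)
    _ = _ := by ring
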